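/- Let X_1, ..., X_d be compact Polish spaces, μ_i ∈ P(X_i), let α : [0,1] → [0,∞) be nondecreasing and bounded, and let b : X_1 × ... × X_d → ℝ be bounded above and upper semi-continuous. Then there exists γ ∈ Γ(μ_1, ..., μ_d) maximizing γ ↦ R_α(b_# γ) over Γ(μ_1, ..., μ_d). -/

import Mathlib

open MeasureTheory Set

/-- Quantile (generalized inverse c.d.f.) of a probability measure on ℝ. -/
noncomputable def quantile (μ : Measure ℝ) (m : ℝ) : ℝ :=
  sInf {x : ℝ | ENNReal.ofReal m ≤ μ (Iic x)}

/-- The spectral risk measure `R_α(μ) = ∫_0^1 F_μ⁻¹(m) α(m) dm`. -/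
noncomputable def specRisk (α : ℝ → ℝ) (μ : Measure ℝ) : ℝ :=
  ∫ m in Icc (0:ℝ) 1, quantile μ m * α m

open Filter Topology

theorem q_bdd (ν : Measure ℝ) [IsProbabilityMeasure ν] {m : ℝ} (hm : 0 < m) :
    BddBelow {x : ℝ | ENNReal.ofReal m ≤ ν (Iic x)} := by
  have h : Tendsto (fun x : ℝ => ν (Iic x)) atBot (𝓝 0) := by
    have h' := tendsto_measure_iInter_atBot (μ := ν) (s := fun x : ℝ => Iic x)
      (fun x => measurableSet_Iic.nullMeasurableSet) (fun x y hxy => Iic_subset_Iic.2 hxy)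
      ⟨0, measure_ne_top _ _⟩
    have h0 : (⋂ x : ℝ, Iic x) = ∅ := by
      ext y
      simpa using exists_lt y
    rwa [h0, measure_empty] at h'
  have h2 := h.eventually (gt_mem_nhds (show (0 : ENNReal) < ENNReal.ofReal m by simpa using hm))
  obtain ⟨y, hy⟩ := h2.exists
  refine ⟨y, fun x hx => ?_⟩
  by_contra hlt
  have : ν (Iic x) ≤ ν (Iic y) := measure_mono (Iic_subset_Iic.2 (not_le.1 hlt).le)
  exact absurd (lt_of_le_of_lt this hy) (not_lt.2 hx)

theorem q_ne (ν : Measure ℝ) [IsProbabilityMeasure ν] {m : ℝ} (hm : m < 1) :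
    {x : ℝ | ENNReal.ofReal m ≤ ν (Iic x)}.Nonempty := by
  have h := tendsto_measure_Iic_atTop ν
  rw [measure_univ] at h
  have h2 := h.eventually (lt_mem_nhds (show ENNReal.ofReal m < 1 by simpa using hm))
  obtain ⟨y, hy⟩ := h2.exists
  exact ⟨y, hy.le⟩

theorem q_le (ν : Measure ℝ) [IsProbabilityMeasure ν] {m x : ℝ} (hm : 0 < m)
    (h : ENNReal.ofReal m ≤ ν (Iic x)) : quantile ν m ≤ x :=
  csInf_le (q_bdd ν hm) h

theorem le_of_q_lt (ν : Measure ℝ) [IsProbabilityMeasure ν] {m x : ℝ} (hm : m < 1)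
    (h : quantile ν m < x) : ENNReal.ofReal m ≤ ν (Iio x) := by
  obtain ⟨y, hy, hyx⟩ := exists_lt_of_csInf_lt (q_ne ν hm) h
  exact le_trans hy (measure_mono (Iic_subset_Iio.2 hyx))

theorem q_mono (ν : Measure ℝ) [IsProbabilityMeasure ν] :
    MonotoneOn (quantile ν) (Ioo 0 1) := by
  intro m hm m' hm' hle
  exact csInf_le_csInf (q_bdd ν hm.1) (q_ne ν hm'.2)
    (fun x hx => le_trans (ENNReal.ofReal_le_ofReal hle) hx)

/-- The loss functional. -/
noncomputable def lossL (α : ℝ → ℝ) (C : ℝ) (ν : Measure ℝ) : ENNReal :=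
  ∫⁻ m in Ioo (0:ℝ) 1, ENNReal.ofReal ((C - quantile ν m) * α m)

theorem f_aem (α : ℝ → ℝ) (hα : MonotoneOn α (Icc 0 1)) (C : ℝ) (ν : Measure ℝ)
    [IsProbabilityMeasure ν] :
    AEMeasurable (fun m => (C - quantile ν m) * α m) (volume.restrict (Ioo (0:ℝ) 1)) :=
  ((aemeasurable_restrict_of_monotoneOn measurableSet_Ioo (q_mono ν)).const_sub C).mul
    (aemeasurable_restrict_of_monotoneOn measurableSet_Ioo (hα.mono Ioo_subset_Icc_self))

theorem loss_lsc {E : Type*} [TopologicalSpace E] [MeasurableSpace E] [BorelSpace E]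
    [HasOuterApproxClosed E] (α : ℝ → ℝ) (hα : MonotoneOn α (Icc 0 1))
    (hα0 : ∀ m ∈ Icc (0:ℝ) 1, 0 ≤ α m) (C : ℝ) (b : E → ℝ) (hb : UpperSemicontinuous b)
    (γs : ℕ → ProbabilityMeasure E) (γ : ProbabilityMeasure E) (h : Tendsto γs atTop (𝓝 γ)) :
    lossL α C ((γ : Measure E).map b) ≤
      liminf (fun n => lossL α C ((γs n : Measure E).map b)) atTop := by
  have hbm : Measurable b := hb.measurable
  have hP : ∀ g : ProbabilityMeasure E, IsProbabilityMeasure ((g : Measure E).map b) :=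
    fun g => Measure.isProbabilityMeasure_map hbm.aemeasurable
  refine le_trans ?_ (lintegral_liminf_le' (fun n => (f_aem α hα C _).ennreal_ofReal))
  have hcount := (q_mono ((γ : Measure E).map b)).countable_not_continuousWithinAt
  have hae : ∀ᵐ m ∂(volume.restrict (Ioo (0:ℝ) 1)),
      m ∉ {x ∈ Ioo (0:ℝ) 1 | ¬ContinuousWithinAt (quantile ((γ : Measure E).map b)) (Ioo 0 1) x} :=
    hcount.ae_notMem _
  apply lintegral_mono_ae
  filter_upwards [hae, ae_restrict_mem measurableSet_Ioo] with m hm1 hm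
  have hc : ContinuousAt (quantile ((γ : Measure E).map b)) m := by
    have : ContinuousWithinAt (quantile ((γ : Measure E).map b)) (Ioo 0 1) m := by
      by_contra hcon
      exact hm1 ⟨hm, hcon⟩
    exact this.continuousAt (Ioo_mem_nhds hm.1 hm.2)
  -- upper semicontinuity of the quantile
  have key : ∀ x, quantile ((γ : Measure E).map b) m < x →
      ∀ᶠ n in atTop, quantile ((γs n : Measure E).map b) m ≤ x := by
    intro x hx
    have h1 : ∀ᶠ m' in 𝓝[>] m, quantile ((γ : Measure E).map b) m' < x ∧ m' < 1 :=
      (((hc.eventually (gt_mem_nhds hx)).and (gt_mem_nhds hm.2)).filter_mono nhdsWithin_le_nhds)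
    obtain ⟨m', ⟨hm'1, hm'2⟩, hm'3⟩ := (h1.and self_mem_nhdsWithin).exists
    have hm'3 : m < m' := hm'3
    have h2 := le_of_q_lt _ hm'2 hm'1
    rw [Measure.map_apply hbm measurableSet_Iio] at h2
    have hopen : IsOpen (b ⁻¹' Iio x) := hb.isOpen_preimage x
    have h3 := ProbabilityMeasure.le_liminf_measure_open_of_tendsto h hopen
    have h4 : ENNReal.ofReal m < liminf (fun n => (γs n : Measure E) (b ⁻¹' Iio x)) atTop :=
      lt_of_lt_of_le ((ENNReal.ofReal_lt_ofReal_iff (hm.1.trans hm'3)).2 hm'3) (h2.trans h3)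
    filter_upwards [eventually_lt_of_lt_liminf h4] with n hn
    apply q_le _ hm.1
    rw [Measure.map_apply hbm measurableSet_Iic]
    exact hn.le.trans (measure_mono (preimage_mono Iio_subset_Iic_self))
  have hαm := hα0 m (Ioo_subset_Icc_self hm)
  set q := quantile ((γ : Measure E).map b) m with hq
  have step : ∀ x, q < x → ENNReal.ofReal ((C - x) * α m) ≤
      liminf (fun n => ENNReal.ofReal ((C - quantile ((γs n : Measure E).map b) m) * α m)) atTop := by
    intro x hx
    refine le_liminf_of_le (by isBoundedDefault) ?_
    filter_upwards [key x hx] with n hn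
    apply ENNReal.ofReal_le_ofReal
    gcongr
  have hcont : Tendsto (fun x : ℝ => ENNReal.ofReal ((C - x) * α m)) (𝓝[>] q)
      (𝓝 (ENNReal.ofReal ((C - q) * α m))) := by
    have : Continuous (fun x : ℝ => ENNReal.ofReal ((C - x) * α m)) :=
      ENNReal.continuous_ofReal.comp (by fun_prop)
    exact (this.tendsto q).mono_left nhdsWithin_le_nhds
  exact le_of_tendsto hcont (by filter_upwards [self_mem_nhdsWithin] with x hx using step x hx)

theorem alpha_int (α : ℝ → ℝ) (hα : MonotoneOn α (Icc 0 1)) :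
    Integrable α (volume.restrict (Ioo (0:ℝ) 1)) :=
  (hα.integrableOn_isCompact isCompact_Icc).mono_set Ioo_subset_Icc_self

theorem specRisk_eq (α : ℝ → ℝ) (hα : MonotoneOn α (Icc 0 1))
    (hα0 : ∀ m ∈ Icc (0:ℝ) 1, 0 ≤ α m) (C : ℝ) (ν : Measure ℝ) [IsProbabilityMeasure ν]
    (hν : ν (Iic C) = 1) :
    (lossL α C ν = ⊤ → specRisk α ν = 0) ∧
    (lossL α C ν ≠ ⊤ → specRisk α ν = C * (∫ m in Ioo (0:ℝ) 1, α m) - (lossL α C ν).toReal) := by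
  have hnn : 0 ≤ᵐ[volume.restrict (Ioo (0:ℝ) 1)] fun m => (C - quantile ν m) * α m := by
    filter_upwards [ae_restrict_mem measurableSet_Ioo] with m hm
    have : quantile ν m ≤ C := q_le ν hm.1 (by rw [hν]; simpa using hm.2.le)
    exact mul_nonneg (sub_nonneg.2 this) (hα0 m (Ioo_subset_Icc_self hm))
  have hm := (f_aem α hα C ν).aestronglyMeasurable
  have hCα : Integrable (fun m => C * α m) (volume.restrict (Ioo (0:ℝ) 1)) :=
    (alpha_int α hα).const_mul C
  have hiff : Integrable (fun m => (C - quantile ν m) * α m) (volume.restrict (Ioo (0:ℝ) 1)) ↔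
      lossL α C ν ≠ ⊤ := (lintegral_ofReal_ne_top_iff_integrable hm hnn).symm
  constructor
  · intro h
    rw [specRisk, integral_Icc_eq_integral_Ioo]
    apply integral_undef
    intro hi
    refine hiff.1 ?_ h
    convert hCα.sub hi using 1
    ext m; simp; ring
  · intro h
    have hi := hiff.2 h
    rw [specRisk, integral_Icc_eq_integral_Ioo, lossL, ← integral_eq_lintegral_of_nonneg_ae hnn hm,
      ← integral_const_mul, ← integral_sub hCα hi]
    congr 1
    ext m; ring

/-- if `b` is bounded above and upper semi-continuous on a product of
compact Polish spaces, then a maximizer of `γ ↦ R_α(b_# γ)` over `Γ(μ_1,...,μ_d)`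
exists. -/
theorem stmt8 (d : ℕ) (X : Fin d → Type*) [∀ i, MeasurableSpace (X i)]
    [∀ i, TopologicalSpace (X i)] [∀ i, PolishSpace (X i)] [∀ i, BorelSpace (X i)]
    [∀ i, CompactSpace (X i)]
    (μ : ∀ i, Measure (X i)) (hμ : ∀ i, IsProbabilityMeasure (μ i))
    (α : ℝ → ℝ) (hα_mono : MonotoneOn α (Icc 0 1))
    (hα_nonneg : ∀ m ∈ Icc (0:ℝ) 1, 0 ≤ α m)
    (b : (∀ i, X i) → ℝ) (hb_usc : UpperSemicontinuous b)
    (hb_bdd : ∃ C, ∀ z, b z ≤ C) :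
    ∃ γ : Measure (∀ i, X i), IsProbabilityMeasure γ ∧
      (∀ i, γ.map (fun z => z i) = μ i) ∧
      ∀ γ' : Measure (∀ i, X i), IsProbabilityMeasure γ' →
        (∀ i, γ'.map (fun z => z i) = μ i) →
        specRisk α (γ'.map b) ≤ specRisk α (γ.map b) := by
  obtain ⟨C, hC⟩ := hb_bdd
  have hbm : Measurable b := hb_usc.measurable
  let K : Set (ProbabilityMeasure (∀ i, X i)) :=
    {γ | ∀ i, (γ : Measure (∀ i, X i)).map (fun z => z i) = μ i}
  have hKcl : IsClosed K := by
    have : K = ⋂ i, {γ : ProbabilityMeasure (∀ i, X i) |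
        γ.map (f := fun z => z i) (measurable_pi_apply i).aemeasurable
          = (⟨μ i, hμ i⟩ : ProbabilityMeasure (X i))} := by
      ext γ
      simp only [K, mem_iInter, mem_ofPred_eq]
      refine forall_congr' fun i => ?_
      exact ⟨fun h => Subtype.ext h, fun h => congrArg Subtype.val h⟩
    rw [this]
    refine isClosed_iInter fun i => ?_
    exact isClosed_eq (ProbabilityMeasure.continuous_map (continuous_apply i)) continuous_const
  have hKc : IsCompact K := hKcl.isCompact
  have hKne : K.Nonempty :=
    ⟨⟨Measure.pi μ, inferInstance⟩, fun i => (measurePreserving_eval μ i).map_eq⟩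
  let L : ProbabilityMeasure (∀ i, X i) → ENNReal :=
    fun γ => lossL α C ((γ : Measure (∀ i, X i)).map b)
  obtain ⟨γ₀, hγ₀K, hγ₀⟩ : ∃ γ ∈ K, ∀ γ' ∈ K, L γ ≤ L γ' := by
    obtain ⟨u, -, hu, huK⟩ := exists_seq_tendsto_sInf (hKne.image L) (OrderBot.bddBelow _)
    choose γs hγsK hγs using huK
    obtain ⟨γ, hγK, φ, hφ, hlim⟩ := hKc.tendsto_subseq hγsK
    refine ⟨γ, hγK, fun γ' hγ' => ?_⟩
    have h1 := loss_lsc α hα_mono hα_nonneg C b hb_usc _ γ hlim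
    have h2 : Tendsto (fun n => L (γs (φ n))) atTop (𝓝 (sInf (L '' K))) := by
      simp only [hγs]
      exact hu.comp hφ.tendsto_atTop
    have h3 : L γ ≤ sInf (L '' K) := h1.trans_eq h2.liminf_eq
    exact h3.trans (sInf_le ⟨γ', hγ', rfl⟩)
  have hspec : ∀ γ : ProbabilityMeasure (∀ i, X i),
      (L γ = ⊤ → specRisk α ((γ : Measure (∀ i, X i)).map b) = 0) ∧
      (L γ ≠ ⊤ → specRisk α ((γ : Measure (∀ i, X i)).map b)
        = C * (∫ m in Ioo (0:ℝ) 1, α m) - (L γ).toReal) := by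
    intro γ
    haveI : IsProbabilityMeasure ((γ : Measure (∀ i, X i)).map b) :=
      Measure.isProbabilityMeasure_map hbm.aemeasurable
    refine specRisk_eq α hα_mono hα_nonneg C _ ?_
    rw [Measure.map_apply hbm measurableSet_Iic]
    have : b ⁻¹' Iic C = univ := eq_univ_of_forall hC
    rw [this, measure_univ]
  suffices hs : ∃ γ ∈ K, ∀ γ' ∈ K, specRisk α ((γ' : Measure (∀ i, X i)).map b)
      ≤ specRisk α ((γ : Measure (∀ i, X i)).map b) by
    obtain ⟨γ, hγ, h⟩ := hs
    exact ⟨γ, inferInstance, hγ, fun γ' hp hm => h ⟨γ', hp⟩ hm⟩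
  have hfin : ∀ γ' ∈ K, L γ' ≠ ⊤ → specRisk α ((γ' : Measure (∀ i, X i)).map b)
      ≤ specRisk α ((γ₀ : Measure (∀ i, X i)).map b) := by
    intro γ' hγ' ht
    have hle := hγ₀ γ' hγ'
    rw [(hspec γ').2 ht, (hspec γ₀).2 (ne_top_of_le_ne_top ht hle)]
    linarith [ENNReal.toReal_mono ht hle]
  -- junk-value case analysis: non-integrable couplings have value `0`
  by_cases hex : ∃ γ₁ ∈ K, L γ₁ = ⊤ ∧ specRisk α ((γ₀ : Measure (∀ i, X i)).map b) ≤ 0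
  · obtain ⟨γ₁, h1K, h1, h0⟩ := hex
    refine ⟨γ₁, h1K, fun γ' hγ' => ?_⟩
    rw [(hspec γ₁).1 h1]
    by_cases ht : L γ' = ⊤
    · rw [(hspec γ').1 ht]
    · exact (hfin γ' hγ' ht).trans h0
  · push Not at hex
    refine ⟨γ₀, hγ₀K, fun γ' hγ' => ?_⟩
    by_cases ht : L γ' = ⊤
    · rw [(hspec γ').1 ht]
      exact (hex γ' hγ' ht).le
    · exact hfin γ' hγ' ht
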